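/- Let N ≥ 2 and let U be a unitary on ℂ^N ⊗ ℂ^N with e_p(U) its entangling power. For n ≥ 1 define U^(n) = U·W_{n−1}·U ⋯ W_1·U, where each W_j = U^A_j ⊗ U^B_j is a local gate. Then the average of e_p(U^(n)) over all the local unitaries U^A_1,…,U^B_{n−1} drawn independently from the Haar probability measure on the unitary group U(N) equals ē_p·[1 − (1 − e_p(U)/ē_p)^n], where ē_p = (N−1)²/(N²+1). -/

import Mathlib

open Matrix MeasureTheory
open scoped Kronecker

noncomputable section

instance {m n R : Type*} [TopologicalSpace R] : MeasurableSpace (Matrix m n R) := borel _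
instance {m n R : Type*} [TopologicalSpace R] : BorelSpace (Matrix m n R) := ⟨rfl⟩

/-- Reshuffling: `(U_R)_{(i,j),(α,β)} = U_{(i,α),(j,β)}`. -/
def reshuffle (N : ℕ) (U : Matrix (Fin N × Fin N) (Fin N × Fin N) ℂ) :
    Matrix (Fin N × Fin N) (Fin N × Fin N) ℂ :=
  Matrix.of fun p q => U (p.1, q.1) (p.2, q.2)

/-- Partial transpose: `(U_Γ)_{(j,α),(i,β)} = U_{(i,α),(j,β)}`. -/
def ptransp (N : ℕ) (U : Matrix (Fin N × Fin N) (Fin N × Fin N) ℂ) :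
    Matrix (Fin N × Fin N) (Fin N × Fin N) ℂ :=
  Matrix.of fun p q => U (q.1, p.2) (p.1, q.2)

/-- The swap gate `S(x ⊗ y) = y ⊗ x`. -/
def swapGate (N : ℕ) : Matrix (Fin N × Fin N) (Fin N × Fin N) ℂ :=
  Matrix.of fun p q => if p.1 = q.2 ∧ p.2 = q.1 then 1 else 0

/-- `ρ_R(U) = U_R U_R† / N²`. -/
def rhoR (N : ℕ) (U : Matrix (Fin N × Fin N) (Fin N × Fin N) ℂ) :
    Matrix (Fin N × Fin N) (Fin N × Fin N) ℂ :=
  ((N : ℂ) ^ 2)⁻¹ • (reshuffle N U * (reshuffle N U)ᴴ)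

/-- `ρ_T(U) = S U_Γ U_Γ† S / N²`. -/
def rhoT (N : ℕ) (U : Matrix (Fin N × Fin N) (Fin N × Fin N) ℂ) :
    Matrix (Fin N × Fin N) (Fin N × Fin N) ℂ :=
  ((N : ℂ) ^ 2)⁻¹ • (swapGate N * (ptransp N U * (ptransp N U)ᴴ) * swapGate N)

/-- Purity `X(U) = tr(ρ_R(U)²)` (a real number). -/
def Xpur (N : ℕ) (U : Matrix (Fin N × Fin N) (Fin N × Fin N) ℂ) : ℝ :=
  ((rhoR N U * rhoR N U).trace).re

/-- Purity `Y(U) = tr(ρ_T(U)²)` (a real number). -/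
def Ypur (N : ℕ) (U : Matrix (Fin N × Fin N) (Fin N × Fin N) ℂ) : ℝ :=
  ((rhoT N U * rhoT N U).trace).re

/-- Entangling power `e_p(U)`. -/
def ep (N : ℕ) (U : Matrix (Fin N × Fin N) (Fin N × Fin N) ℂ) : ℝ :=
  ((N : ℝ) ^ 2 / ((N : ℝ) + 1) ^ 2) *
    ((1 - Xpur N U) + (1 - Ypur N U) - ((N : ℝ) ^ 2 - 1) / (N : ℝ) ^ 2)

/-- Gate typicality `g_t(U)`. -/
def gateTyp (N : ℕ) (U : Matrix (Fin N × Fin N) (Fin N × Fin N) ℂ) : ℝ :=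
  ((N : ℝ) ^ 2 / ((N : ℝ) ^ 2 - 1)) *
    (Ypur N U - Xpur N U + ((N : ℝ) ^ 2 - 1) / (N : ℝ) ^ 2)

/-- Mean entangling power over the Haar measure, `ē_p = (N-1)²/(N²+1)`. -/
def epBar (N : ℕ) : ℝ := ((N : ℝ) - 1) ^ 2 / ((N : ℝ) ^ 2 + 1)

/-- `iterGate U W k = U · W_{k-1} · U ⋯ W_0 · U`, i.e. `U^(k+1)` with `k` interlacing
local gates `W_0, …, W_{k-1}`. -/
def iterGate {D : Type*} [Fintype D] [DecidableEq D] (U : Matrix D D ℂ)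
    (W : ℕ → Matrix D D ℂ) : ℕ → Matrix D D ℂ
  | 0 => U
  | k + 1 => U * W k * iterGate U W k

/-- If `K` commutes with `u ⊗ u` for all unitary `u`, it commutes with the infinitesimal action
of every orthogonal projection. -/
lemma commute_kronecker_add_of_projection {n : Type*} [Fintype n] [DecidableEq n]
    {K : Matrix (n × n) (n × n) ℂ}
    (hK : ∀ u ∈ Matrix.unitaryGroup n ℂ, Commute (u ⊗ₖ u) K)
    {p : Matrix n n ℂ} (hp : p * p = p) (hs : pᴴ = p) :
    Commute (p ⊗ₖ (1 : Matrix n n ℂ) + (1 : Matrix n n ℂ) ⊗ₖ p) K := by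
  have key : ∀ x : ℂ, star x + x + star x * x = 0 →
      Commute (x • (p ⊗ₖ (1 : Matrix n n ℂ) + (1 : Matrix n n ℂ) ⊗ₖ p) + (x * x) • (p ⊗ₖ p)) K := by
    intro x hx
    have hu : (1 + x • p) ∈ Matrix.unitaryGroup n ℂ := by
      rw [Matrix.mem_unitaryGroup_iff', star_eq_conjTranspose, conjTranspose_add,
        conjTranspose_smul, hs, conjTranspose_one]
      have : (1 + star x • p) * (1 + x • p) = 1 + (star x + x + star x * x) • p := by
        simp only [add_mul, mul_add, one_mul, mul_one, smul_mul_assoc, mul_smul_comm, hp,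
          add_smul]
        module
      rw [this, hx, zero_smul, add_zero]
    have e : x • (p ⊗ₖ (1 : Matrix n n ℂ) + (1 : Matrix n n ℂ) ⊗ₖ p) + (x * x) • (p ⊗ₖ p) =
        (1 + x • p) ⊗ₖ (1 + x • p) - 1 := by
      rw [add_kronecker, kronecker_add, kronecker_add, one_kronecker_one, smul_kronecker,
        smul_kronecker, kronecker_smul, kronecker_smul]
      module
    rw [e]
    exact (hK _ hu).sub_left (Commute.one_left K)
  have h₁ := key (-2) (by simp; norm_num)
  have h₂ := key (Complex.I - 1) (by simp [Complex.ext_iff])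
  have e : p ⊗ₖ (1 : Matrix n n ℂ) + (1 : Matrix n n ℂ) ⊗ₖ p =
      (-Complex.I / 2) • ((-2 : ℂ) • (p ⊗ₖ (1 : Matrix n n ℂ) + (1 : Matrix n n ℂ) ⊗ₖ p) +
        ((-2 : ℂ) * -2) • (p ⊗ₖ p)) -
      ((Complex.I - 1) • (p ⊗ₖ (1 : Matrix n n ℂ) + (1 : Matrix n n ℂ) ⊗ₖ p) +
        ((Complex.I - 1) * (Complex.I - 1)) • (p ⊗ₖ p)) := by
    have e' : (Complex.I - 1) * (Complex.I - 1) = -2 * Complex.I := by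
      linear_combination Complex.I_mul_I
    rw [e']
    module
  rw [e]
  exact (h₁.smul_left _).sub_left h₂

/-- If `K` commutes with `u ⊗ u` for all unitary `u`, it commutes with the infinitesimal action
of every matrix unit. -/
lemma commute_kronecker_add_single {n : Type*} [Fintype n] [DecidableEq n]
    {K : Matrix (n × n) (n × n) ℂ}
    (hK : ∀ u ∈ Matrix.unitaryGroup n ℂ, Commute (u ⊗ₖ u) K) (a b : n) :
    Commute (single a b (1 : ℂ) ⊗ₖ (1 : Matrix n n ℂ) +
      (1 : Matrix n n ℂ) ⊗ₖ single a b (1 : ℂ)) K := by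
  have hd : ∀ c : n, Commute (single c c (1 : ℂ) ⊗ₖ (1 : Matrix n n ℂ) +
      (1 : Matrix n n ℂ) ⊗ₖ single c c (1 : ℂ)) K := fun c =>
    commute_kronecker_add_of_projection hK (by simp) (by simp)
  rcases eq_or_ne a b with rfl | hab
  · exact hd a
  have h₀ : ∀ i j k l : n, j ≠ k → single i j (1 : ℂ) * single k l (1 : ℂ) = 0 :=
    fun i j k l h => by simp [single_mul_single_of_ne, h]
  have h₁ : Commute _ K := commute_kronecker_add_of_projection hK
    (p := (1 / 2 : ℂ) • (single a a 1 + single b b 1 + single a b 1 + single b a 1))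
    (by
      simp only [smul_mul_smul_comm, add_mul, mul_add, single_mul_single_same, mul_one, h₀ _ _ _ _ hab,
        h₀ _ _ _ _ hab.symm]
      module)
    (by
      simp only [conjTranspose_smul, conjTranspose_add, conjTranspose_single, star_one]
      simp
      abel)
  have h₂ : Commute _ K := commute_kronecker_add_of_projection hK
    (p := (1 / 2 : ℂ) • (single a a 1 + single b b 1 + (-Complex.I) • single a b 1
      + Complex.I • single b a 1))
    (by
      rw [smul_mul_smul_comm]
      simp only [add_mul, mul_add, mul_smul_comm, smul_mul_assoc, single_mul_single_same, mul_one,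
        h₀ _ _ _ _ hab, h₀ _ _ _ _ hab.symm]
      match_scalars <;> grind [Complex.I_sq])
    (by
      simp only [conjTranspose_smul, conjTranspose_add, conjTranspose_single, star_one, star_neg]
      simp [-smul_single]
      abel)
  have e : single a b (1 : ℂ) =
      (1 / 2 : ℂ) • (single a a 1 + single b b 1 + single a b 1 + single b a 1) +
      Complex.I • ((1 / 2 : ℂ) • (single a a 1 + single b b 1 + (-Complex.I) • single a b 1
        + Complex.I • single b a 1)) -
      ((1 + Complex.I) / 2) • (single a a 1 + single b b 1) := by
    simp only [smul_add, smul_smul]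
    have e₁ : Complex.I * (1 / 2 * -Complex.I) = 1 / 2 := by
      linear_combination (-1 / 2 : ℂ) * Complex.I_mul_I
    have e₂ : Complex.I * (1 / 2 * Complex.I) = -1 / 2 := by
      linear_combination (1 / 2 : ℂ) * Complex.I_mul_I
    rw [← mul_assoc, mul_assoc, e₁, e₂]
    module
  have h := (h₁.add_left (h₂.smul_left Complex.I)).sub_left
    (((hd a).add_left (hd b)).smul_left ((1 + Complex.I) / 2))
  rw [e]
  generalize (1 / 2 : ℂ) • (single a a (1 : ℂ) + single b b 1 + single a b 1 + single b a 1) = p₁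
    at h ⊢
  generalize (1 / 2 : ℂ) • (single a a (1 : ℂ) + single b b 1 + (-Complex.I) • single a b 1
        + Complex.I • single b a 1) = p₂ at h ⊢
  have e' : (p₁ + Complex.I • p₂ - ((1 + Complex.I) / 2) • (single a a 1 + single b b 1)) ⊗ₖ
        (1 : Matrix n n ℂ) + (1 : Matrix n n ℂ) ⊗ₖ
        (p₁ + Complex.I • p₂ - ((1 + Complex.I) / 2) • (single a a 1 + single b b 1)) =
      p₁ ⊗ₖ 1 + 1 ⊗ₖ p₁ + Complex.I • (p₂ ⊗ₖ 1 + 1 ⊗ₖ p₂) -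
        ((1 + Complex.I) / 2) • (single a a 1 ⊗ₖ 1 + 1 ⊗ₖ single a a 1 +
          (single b b 1 ⊗ₖ 1 + 1 ⊗ₖ single b b 1)) := by
    simp only [sub_eq_add_neg, ← neg_smul, add_kronecker, kronecker_add, smul_kronecker,
      kronecker_smul]
    module
  rw [e']
  exact h

lemma single_kronecker_one_mul_apply {n : Type*} [Fintype n] [DecidableEq n]
    (K : Matrix (n × n) (n × n) ℂ) (a b i i' : n) (q : n × n) :
    (single a b (1 : ℂ) ⊗ₖ (1 : Matrix n n ℂ) * K) (i, i') q = if i = a then K (b, i') q else 0 := by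
  rcases eq_or_ne i a with rfl | h
  · simp [Matrix.mul_apply, Fintype.sum_prod_type, single_apply, one_apply]
  · simp [Matrix.mul_apply, one_apply, h, h.symm]

lemma one_kronecker_single_mul_apply {n : Type*} [Fintype n] [DecidableEq n]
    (K : Matrix (n × n) (n × n) ℂ) (a b i i' : n) (q : n × n) :
    ((1 : Matrix n n ℂ) ⊗ₖ single a b (1 : ℂ) * K) (i, i') q = if i' = a then K (i, b) q else 0 := by
  rcases eq_or_ne i' a with rfl | h
  · simp [Matrix.mul_apply, Fintype.sum_prod_type, single_apply, one_apply]
  · simp [Matrix.mul_apply, one_apply, h, h.symm]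

lemma mul_single_kronecker_one_apply {n : Type*} [Fintype n] [DecidableEq n]
    (K : Matrix (n × n) (n × n) ℂ) (a b j j' : n) (p : n × n) :
    (K * single a b (1 : ℂ) ⊗ₖ (1 : Matrix n n ℂ)) p (j, j') = if j = b then K p (a, j') else 0 := by
  rcases eq_or_ne j b with rfl | h
  · simp [Matrix.mul_apply, Fintype.sum_prod_type, single_apply, one_apply]
  · simp [Matrix.mul_apply, one_apply, h, h.symm]

lemma mul_one_kronecker_single_apply {n : Type*} [Fintype n] [DecidableEq n]
    (K : Matrix (n × n) (n × n) ℂ) (a b j j' : n) (p : n × n) :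
    (K * (1 : Matrix n n ℂ) ⊗ₖ single a b (1 : ℂ)) p (j, j') = if j' = b then K p (j, a) else 0 := by
  rcases eq_or_ne j' b with rfl | h
  · simp [Matrix.mul_apply, Fintype.sum_prod_type, single_apply, one_apply]
  · simp [Matrix.mul_apply, one_apply, h, h.symm]

/-- The commutant of `{u ⊗ u}` is spanned by the identity and the swap. -/
lemma eq_smul_one_add_smul_swapGate {N : ℕ} {K : Matrix (Fin N × Fin N) (Fin N × Fin N) ℂ}
    (hK : ∀ u ∈ Matrix.unitaryGroup (Fin N) ℂ, Commute (u ⊗ₖ u) K) {o t : Fin N} (hot : o ≠ t) :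
    K = K (o, t) (o, t) • 1 + K (o, t) (t, o) • swapGate N := by
  have hE : ∀ a b i i' j j' : Fin N,
      (if i = a then K (b, i') (j, j') else 0) + (if i' = a then K (i, b) (j, j') else 0) =
      (if j = b then K (i, i') (a, j') else 0) + (if j' = b then K (i, i') (j, a) else 0) := by
    intro a b i i' j j'
    have h := congr_fun₂ (commute_kronecker_add_single hK a b).eq (i, i') (j, j')
    simpa only [add_mul, mul_add, Matrix.add_apply, single_kronecker_one_mul_apply,
      one_kronecker_single_mul_apply, mul_single_kronecker_one_apply,
      mul_one_kronecker_single_apply] using h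
  have hx₁ : ∀ a b c, a ≠ b → a ≠ c → b ≠ c → K (a, c) (a, c) = K (b, c) (b, c) := by
    intro a b c hab hac hbc
    simpa [hab, hab.symm, hac, hac.symm, hbc, hbc.symm] using (hE a b a c b c).symm
  have hz₁ : ∀ a b c, a ≠ b → a ≠ c → b ≠ c → K (a, c) (c, a) = K (b, c) (c, b) := by
    intro a b c hab hac hbc
    simpa [hab, hab.symm, hac, hac.symm, hbc, hbc.symm] using (hE a b a c c b).symm
  have hs : ∀ a b, a ≠ b → K (a, b) (a, b) = K (b, a) (b, a) ∧ K (a, b) (b, a) = K (b, a) (a, b) ∧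
      K (a, a) (a, a) = K (a, b) (a, b) + K (a, b) (b, a) ∧
      K (b, b) (b, b) = K (a, b) (a, b) + K (a, b) (b, a) := by
    intro a b hab
    have e₁ := hE a b a b b b
    have e₂ := hE a b b a b b
    have e₃ := hE a b a a a b
    have e₄ := hE a b a a b a
    simp [hab, hab.symm] at e₁ e₂ e₃ e₄
    refine ⟨?_, ?_, ?_, ?_⟩ <;> grind
  have hrow : ∀ f : Fin N → Fin N → ℂ, (∀ a b, a ≠ b → f a b = f b a) →
      (∀ a b c, a ≠ b → a ≠ c → b ≠ c → f a c = f b c) → ∀ a b, a ≠ b → f a b = f o t := by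
    intro f hf hf' a b hab
    clear hE hx₁ hz₁ hs hK
    have e₁ := hf' a t b
    have e₂ := hf b t
    have e₃ := hf' b o t
    have e₄ := hf' a o t
    grind
  have hx := hrow (fun a b => K (a, b) (a, b)) (fun a b h => (hs a b h).1) hx₁
  have hz := hrow (fun a b => K (a, b) (b, a)) (fun a b h => (hs a b h).2.1) hz₁
  beta_reduce at hx hz
  have hc : ∀ a, K (a, a) (a, a) = K (o, t) (o, t) + K (o, t) (t, o) := by
    intro a
    rcases eq_or_ne a o with rfl | h
    · exact (hs a t hot).2.2.1
    · rw [(hs a o h).2.2.1, hx a o h, hz a o h]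
  have h₀ : ∀ i i' j j', ¬ (i = j ∧ i' = j') → ¬ (i = j' ∧ i' = j) → K (i, i') (j, j') = 0 := by
    intro i i' j j' h h'
    have e₀ := hE i i i i' j j'
    have e₁ := hE i' i' i i' j j'
    have e₂ := hE j j i i' j j'
    have e₃ := hE j' j' i i' j j'
    clear hE hx₁ hz₁ hs hK hx hz hc
    grind
  ext ⟨i, i'⟩ ⟨j, j'⟩
  simp only [Matrix.add_apply, Matrix.smul_apply, one_apply, swapGate, of_apply, Prod.mk.injEq,
    smul_eq_mul, mul_ite, mul_one, mul_zero]
  clear hE hx₁ hz₁ hs hK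
  grind

lemma kronecker_one_mul_apply {m k l : Type*} [Fintype m] [Fintype k] [DecidableEq k]
    (A : Matrix m m ℂ) (M : Matrix (m × k) l ℂ) (p : m × k) (q : l) :
    ((A ⊗ₖ (1 : Matrix k k ℂ)) * M) p q = (A * M.submatrix (·, p.2) id) p.1 q := by
  simp [Matrix.mul_apply, Fintype.sum_prod_type, one_apply]

lemma one_kronecker_mul_apply {m k l : Type*} [Fintype m] [Fintype k] [DecidableEq m]
    (A : Matrix k k ℂ) (M : Matrix (m × k) l ℂ) (p : m × k) (q : l) :
    (((1 : Matrix m m ℂ) ⊗ₖ A) * M) p q = (A * M.submatrix (p.1, ·) id) p.2 q := by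
  simp [Matrix.mul_apply, Fintype.sum_prod_type_right, one_apply]

lemma mul_kronecker_one_apply {m k l : Type*} [Fintype m] [Fintype k] [DecidableEq k]
    (A : Matrix m m ℂ) (M : Matrix l (m × k) ℂ) (p : l) (q : m × k) :
    (M * (A ⊗ₖ (1 : Matrix k k ℂ))) p q = (M.submatrix id (·, q.2) * A) p q.1 := by
  simp [Matrix.mul_apply, Fintype.sum_prod_type, one_apply]

lemma mul_one_kronecker_apply {m k l : Type*} [Fintype m] [Fintype k] [DecidableEq m]
    (A : Matrix k k ℂ) (M : Matrix l (m × k) ℂ) (p : l) (q : m × k) :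
    (M * ((1 : Matrix m m ℂ) ⊗ₖ A)) p q = (M.submatrix id (q.1, ·) * A) p q.2 := by
  simp [Matrix.mul_apply, Fintype.sum_prod_type_right, one_apply]

/-- The commutant of `{(u ⊗ u) ⊗ (v ⊗ v)}` is spanned by products of the identity and the swap. -/
lemma exists_eq_add_smul_kronecker_swapGate {N : ℕ}
    {M : Matrix ((Fin N × Fin N) × (Fin N × Fin N)) ((Fin N × Fin N) × (Fin N × Fin N)) ℂ}
    (hA : ∀ u ∈ Matrix.unitaryGroup (Fin N) ℂ,
      Commute ((u ⊗ₖ u) ⊗ₖ (1 : Matrix (Fin N × Fin N) (Fin N × Fin N) ℂ)) M)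
    (hB : ∀ u ∈ Matrix.unitaryGroup (Fin N) ℂ,
      Commute ((1 : Matrix (Fin N × Fin N) (Fin N × Fin N) ℂ) ⊗ₖ (u ⊗ₖ u)) M)
    {o t : Fin N} (hot : o ≠ t) :
    ∃ a b c d : ℂ, M = a • 1 + b • (swapGate N ⊗ₖ 1) + c • (1 ⊗ₖ swapGate N) +
      d • (swapGate N ⊗ₖ swapGate N) := by
  have hrow : ∀ p q, M.submatrix (·, p) (·, q) =
      M ((o, t), p) ((o, t), q) • 1 + M ((o, t), p) ((t, o), q) • swapGate N := by
    intro p q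
    refine eq_smul_one_add_smul_swapGate (K := M.submatrix (·, p) (·, q)) (fun u hu => ?_) hot
    ext x y
    have h := congr_fun₂ (hA u hu).eq (x, p) (y, q)
    rw [kronecker_one_mul_apply, mul_kronecker_one_apply] at h
    exact h
  have hcol : ∀ x y, M.submatrix (x, ·) (y, ·) =
      M (x, (o, t)) (y, (o, t)) • 1 + M (x, (o, t)) (y, (t, o)) • swapGate N := by
    intro x y
    refine eq_smul_one_add_smul_swapGate (K := M.submatrix (x, ·) (y, ·)) (fun u hu => ?_) hot
    ext p q
    have h := congr_fun₂ (hB u hu).eq (x, p) (y, q)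
    rw [one_kronecker_mul_apply, mul_one_kronecker_apply] at h
    exact h
  refine ⟨M ((o, t), (o, t)) ((o, t), (o, t)), M ((o, t), (o, t)) ((t, o), (o, t)),
    M ((o, t), (o, t)) ((o, t), (t, o)), M ((o, t), (o, t)) ((t, o), (t, o)), ?_⟩
  ext ⟨x, p⟩ ⟨y, q⟩
  have h := congr_fun₂ (hrow p q) x y
  have h₁ := congr_fun₂ (hcol (o, t) (o, t)) p q
  have h₂ := congr_fun₂ (hcol (o, t) (t, o)) p q
  simp only [submatrix_apply, Matrix.add_apply, Matrix.smul_apply, smul_eq_mul] at h h₁ h₂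
  have h₃ : (1 : Matrix ((Fin N × Fin N) × (Fin N × Fin N)) _ ℂ) (x, p) (y, q) =
      (1 : Matrix (Fin N × Fin N) _ ℂ) x y * (1 : Matrix (Fin N × Fin N) _ ℂ) p q := by
    rw [← one_kronecker_one, kroneckerMap_apply]
  rw [h, h₁, h₂]
  simp only [Matrix.add_apply, Matrix.smul_apply, smul_eq_mul, kroneckerMap_apply, h₃]
  ring

lemma swapGate_mul_apply {N : ℕ} {m : Type*} (M : Matrix (Fin N × Fin N) m ℂ) (p : Fin N × Fin N)
    (q : m) : (swapGate N * M) p q = M p.swap q := by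
  have h : ∀ r : Fin N × Fin N, (p.1 = r.2 ∧ p.2 = r.1) ↔ p.swap = r := by
    intro r
    rw [Prod.ext_iff]
    exact and_comm
  simp [swapGate, Matrix.mul_apply, h]

lemma mul_swapGate_apply {N : ℕ} {m : Type*} (M : Matrix m (Fin N × Fin N) ℂ) (q : Fin N × Fin N)
    (p : m) : (M * swapGate N) p q = M p q.swap := by
  have h : ∀ r : Fin N × Fin N, (r.1 = q.2 ∧ r.2 = q.1) ↔ r = q.swap := by
    intro r
    rw [Prod.ext_iff]
    rfl
  simp [swapGate, Matrix.mul_apply, h]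

lemma swapGate_mul_swapGate (N : ℕ) : swapGate N * swapGate N = 1 := by
  ext p q
  rw [swapGate_mul_apply, swapGate, of_apply, one_apply]
  congr 1
  grind

lemma trace_swapGate (N : ℕ) : (swapGate N).trace = N := by
  simp [Matrix.trace, swapGate, Fintype.sum_prod_type, ite_and, eq_comm]

lemma commute_kronecker_self_swapGate {N : ℕ} (u : Matrix (Fin N) (Fin N) ℂ) :
    Commute (u ⊗ₖ u) (swapGate N) := by
  ext p q
  rw [mul_swapGate_apply, swapGate_mul_apply]
  simp [kroneckerMap_apply, mul_comm]

/-- `V ⊗ V` with the two copies of each tensor factor grouped together. -/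
def doubled {N : ℕ} (V : Matrix (Fin N × Fin N) (Fin N × Fin N) ℂ) :
    Matrix ((Fin N × Fin N) × (Fin N × Fin N)) ((Fin N × Fin N) × (Fin N × Fin N)) ℂ :=
  (V ⊗ₖ V).submatrix (Equiv.prodProdProdComm _ _ _ _) (Equiv.prodProdProdComm _ _ _ _)

lemma doubled_apply {N : ℕ} (V : Matrix (Fin N × Fin N) (Fin N × Fin N) ℂ) (p q) :
    doubled V p q =
      V (p.1.1, p.2.1) (q.1.1, q.2.1) * V (p.1.2, p.2.2) (q.1.2, q.2.2) := rfl

lemma doubled_mul {N : ℕ} (U V : Matrix (Fin N × Fin N) (Fin N × Fin N) ℂ) :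
    doubled (U * V) = doubled U * doubled V := by
  rw [doubled, doubled, doubled, submatrix_mul_equiv, mul_kronecker_mul]

lemma doubled_conjTranspose {N : ℕ} (V : Matrix (Fin N × Fin N) (Fin N × Fin N) ℂ) :
    doubled Vᴴ = (doubled V)ᴴ := by
  rw [doubled, doubled, conjTranspose_submatrix, conjTranspose_kronecker]

lemma doubled_one (N : ℕ) : doubled (1 : Matrix (Fin N × Fin N) (Fin N × Fin N) ℂ) = 1 := by
  rw [doubled, one_kronecker_one, submatrix_one_equiv]

lemma doubled_kronecker {N : ℕ} (u v : Matrix (Fin N) (Fin N) ℂ) :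
    doubled (u ⊗ₖ v) = (u ⊗ₖ u) ⊗ₖ (v ⊗ₖ v) := by
  ext p q
  simp only [doubled_apply, kroneckerMap_apply]
  ring

lemma conjTranspose_doubled_mul_doubled {N : ℕ} {V : Matrix (Fin N × Fin N) (Fin N × Fin N) ℂ}
    (hV : V ∈ Matrix.unitaryGroup (Fin N × Fin N) ℂ) : (doubled V)ᴴ * doubled V = 1 := by
  rw [← doubled_conjTranspose, ← doubled_mul, ← star_eq_conjTranspose,
    Matrix.mem_unitaryGroup_iff'.mp hV, doubled_one]

lemma commute_doubled_swapGate {N : ℕ} (V : Matrix (Fin N × Fin N) (Fin N × Fin N) ℂ) :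
    Commute (doubled V) (swapGate N ⊗ₖ swapGate N) := by
  have h : swapGate N ⊗ₖ swapGate N = (swapGate N ⊗ₖ 1) * (1 ⊗ₖ swapGate N) := by
    rw [← mul_kronecker_mul, one_mul, mul_one]
  ext p q
  rw [h, ← mul_assoc, mul_one_kronecker_apply, mul_swapGate_apply, submatrix_apply,
    mul_kronecker_one_apply, mul_swapGate_apply, mul_assoc, kronecker_one_mul_apply,
    swapGate_mul_apply, submatrix_apply, submatrix_apply,
    one_kronecker_mul_apply, swapGate_mul_apply]
  simp [doubled_apply, mul_comm]

/-- `N⁴ (X(V) + Y(V))` as a trace over two copies of the bipartite space. -/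
def purityTrace (N : ℕ) (V : Matrix (Fin N × Fin N) (Fin N × Fin N) ℂ) : ℂ :=
  (doubled V * (swapGate N ⊗ₖ 1 + 1 ⊗ₖ swapGate N) * (doubled V)ᴴ * (swapGate N ⊗ₖ 1)).trace

lemma trace_reshuffle (N : ℕ) (V : Matrix (Fin N × Fin N) (Fin N × Fin N) ℂ) :
    (reshuffle N V * (reshuffle N V)ᴴ * (reshuffle N V * (reshuffle N V)ᴴ)).trace =
      (doubled V * (swapGate N ⊗ₖ 1) * (doubled V)ᴴ * (swapGate N ⊗ₖ 1)).trace := by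
  simp only [Matrix.trace, diag_apply, mul_kronecker_one_apply, mul_swapGate_apply,
    submatrix_apply, id]
  simp only [Matrix.mul_apply (M := doubled V * _), mul_kronecker_one_apply, mul_swapGate_apply,
    submatrix_apply, id, conjTranspose_apply, doubled_apply, star_mul']
  simp only [Matrix.mul_apply, Finset.sum_mul, Finset.mul_sum, conjTranspose_apply, reshuffle,
    of_apply, ← Fintype.sum_prod_type']
  refine Fintype.sum_equiv
    { toFun := fun x =>
        (((x.1.1, x.2.1.1), (x.2.2.2.1, x.2.2.1.1)), ((x.2.1.2, x.1.2), (x.2.2.2.2, x.2.2.1.2)))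
      invFun := fun y =>
        ((y.1.1.1, y.2.1.2), ((y.1.1.2, y.2.1.1), ((y.1.2.2, y.2.2.2), (y.1.2.1, y.2.2.1))))
      left_inv := fun _ => rfl
      right_inv := fun _ => rfl } _ _ fun x => ?_
  simp only [Equiv.coe_fn_mk, Prod.swap]
  ring

lemma trace_ptransp (N : ℕ) (V : Matrix (Fin N × Fin N) (Fin N × Fin N) ℂ) :
    (ptransp N V * (ptransp N V)ᴴ * (ptransp N V * (ptransp N V)ᴴ)).trace =
      (doubled V * (1 ⊗ₖ swapGate N) * (doubled V)ᴴ * (swapGate N ⊗ₖ 1)).trace := by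
  simp only [Matrix.trace, diag_apply, mul_kronecker_one_apply, mul_swapGate_apply,
    submatrix_apply, id]
  simp only [Matrix.mul_apply (M := doubled V * _), mul_one_kronecker_apply, mul_swapGate_apply,
    submatrix_apply, id, conjTranspose_apply, doubled_apply, star_mul']
  simp only [Matrix.mul_apply, Finset.sum_mul, Finset.mul_sum, conjTranspose_apply, ptransp,
    of_apply, ← Fintype.sum_prod_type']
  refine Fintype.sum_equiv
    { toFun := fun x =>
        (((x.2.2.2.1, x.2.2.1.1), (x.1.2, x.2.1.2)), ((x.1.1, x.2.1.1), (x.2.2.1.2, x.2.2.2.2)))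
      invFun := fun y =>
        ((y.2.1.1, y.1.2.1), ((y.2.1.2, y.1.2.2), ((y.1.1.2, y.2.2.1), (y.1.1.1, y.2.2.2))))
      left_inv := fun _ => rfl
      right_inv := fun _ => rfl } _ _ fun x => ?_
  simp only [Equiv.coe_fn_mk, Prod.swap]
  ring

lemma purityTrace_eq (N : ℕ) (V : Matrix (Fin N × Fin N) (Fin N × Fin N) ℂ) :
    purityTrace N V =
      (reshuffle N V * (reshuffle N V)ᴴ * (reshuffle N V * (reshuffle N V)ᴴ)).trace +
      (ptransp N V * (ptransp N V)ᴴ * (ptransp N V * (ptransp N V)ᴴ)).trace := by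
  rw [trace_reshuffle, trace_ptransp, purityTrace, mul_add, add_mul, add_mul, trace_add]

lemma Xpur_add_Ypur (N : ℕ) (V : Matrix (Fin N × Fin N) (Fin N × Fin N) ℂ) :
    Xpur N V + Ypur N V = (purityTrace N V).re / (N : ℝ) ^ 4 := by
  have h : (((N : ℂ) ^ 2)⁻¹ * ((N : ℂ) ^ 2)⁻¹) = (((N : ℝ) ^ 4)⁻¹ : ℝ) := by
    push_cast
    rw [← mul_inv]
    ring
  have hS : ∀ T : Matrix (Fin N × Fin N) (Fin N × Fin N) ℂ,
      (swapGate N * T * swapGate N * (swapGate N * T * swapGate N)).trace = (T * T).trace := by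
    intro T
    have hT : swapGate N * T * swapGate N * (swapGate N * T * swapGate N) =
        swapGate N * (T * (swapGate N * swapGate N) * T * swapGate N) := by
      simp only [mul_assoc]
    rw [hT, trace_mul_comm, mul_assoc, swapGate_mul_swapGate, mul_one, mul_one]
  rw [Xpur, Ypur, rhoR, rhoT, purityTrace_eq]
  simp only [Matrix.smul_mul, Matrix.mul_smul, trace_smul, hS, smul_smul, h, smul_eq_mul,
    Complex.re_ofReal_mul, Complex.add_re]
  ring

lemma ep_eq {N : ℕ} (hN : 2 ≤ N) (V : Matrix (Fin N × Fin N) (Fin N × Fin N) ℂ) :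
    ep N V = ((N : ℝ) ^ 2 * ((N : ℝ) ^ 2 + 1) - (purityTrace N V).re) /
      ((N : ℝ) ^ 2 * ((N : ℝ) + 1) ^ 2) := by
  have h : Ypur N V = (purityTrace N V).re / (N : ℝ) ^ 4 - Xpur N V := by
    rw [← Xpur_add_Ypur]
    ring
  have hN0 : (N : ℝ) ≠ 0 := by positivity
  have hN1 : (N : ℝ) + 1 ≠ 0 := by positivity
  rw [ep, h]
  field_simp
  ring

lemma purityTrace_im (N : ℕ) (V : Matrix (Fin N × Fin N) (Fin N × Fin N) ℂ) :
    (purityTrace N V).im = 0 := by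
  have h : ∀ T : Matrix (Fin N × Fin N) (Fin N × Fin N) ℂ,
      star (T * Tᴴ * (T * Tᴴ)).trace = (T * Tᴴ * (T * Tᴴ)).trace := by
    intro T
    rw [← trace_conjTranspose]
    simp only [conjTranspose_mul, conjTranspose_conjTranspose]
  rw [purityTrace_eq, ← Complex.conj_eq_iff_im, ← Complex.star_def, star_add, h, h]

/-- The average of `tr (E C)` in terms of the components of `E` and `C` along the swaps. -/
lemma trace_mul_eq_of_swapGate_components {N : ℕ} (hN : 2 ≤ N)
    {E C : Matrix ((Fin N × Fin N) × (Fin N × Fin N)) ((Fin N × Fin N) × (Fin N × Fin N)) ℂ}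
    {a b c d u v : ℂ} (hE : E = a • 1 + b • (swapGate N ⊗ₖ 1) + c • (1 ⊗ₖ swapGate N) +
      d • (swapGate N ⊗ₖ swapGate N))
    (h₀ : E.trace = 2 * (N : ℂ) ^ 3)
    (hF : (E * (swapGate N ⊗ₖ swapGate N)).trace = 2 * (N : ℂ) ^ 3)
    (hA : (E * (swapGate N ⊗ₖ 1)).trace = v) (hB : (E * (1 ⊗ₖ swapGate N)).trace = v)
    (hC₀ : C.trace = (N : ℂ) ^ 3) (hCF : ((swapGate N ⊗ₖ swapGate N) * C).trace = (N : ℂ) ^ 3)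
    (hC : ((swapGate N ⊗ₖ 1 + 1 ⊗ₖ swapGate N) * C).trace = u) :
    (N : ℂ) ^ 2 * ((N : ℂ) ^ 2 - 1) ^ 2 * ((E * C).trace - v) =
      (v * ((N : ℂ) ^ 2 + 1) - 4 * (N : ℂ) ^ 4) * (u - (N : ℂ) ^ 2 * ((N : ℂ) ^ 2 + 1)) := by
  have hN0 : (N : ℂ) ≠ 0 := by
    exact_mod_cast (by lia : N ≠ 0)
  have hN1 : (N : ℂ) ^ 2 - 1 ≠ 0 := by
    have : (N : ℝ) ^ 2 - 1 ≠ 0 := by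
      have : (2 : ℝ) ≤ N := by exact_mod_cast hN
      nlinarith
    exact_mod_cast this
  subst hE
  simp only [add_mul, Matrix.smul_mul, one_mul, ← mul_kronecker_mul, mul_one,
    swapGate_mul_swapGate, trace_add, trace_smul, trace_kronecker, trace_swapGate, trace_one,
    Fintype.card_prod, Fintype.card_fin, smul_eq_mul, hC₀, hCF] at *
  push_cast at *
  have had : a = d := by
    refine mul_left_cancel₀ (mul_ne_zero (pow_ne_zero 2 hN0) hN1) ?_
    linear_combination h₀ - hF
  have hbc : b = c := by
    refine mul_left_cancel₀ (mul_ne_zero (pow_ne_zero 2 hN0) hN1) ?_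
    linear_combination hA - hB
  subst had hbc
  subst hA
  have hab : a * ((N : ℂ) ^ 2 + 1) + 2 * b * N = 2 * N := by
    refine mul_left_cancel₀ (pow_ne_zero 2 hN0) ?_
    linear_combination h₀
  linear_combination (N : ℂ) ^ 2 * ((N : ℂ) ^ 2 - 1) ^ 2 * b * hC -
    2 * (N : ℂ) ^ 3 * (u - (N : ℂ) ^ 2 * ((N : ℂ) ^ 2 + 1)) * hab

/-- Two copies of the gate `V`, acting by conjugation on the sum of the two swaps. -/
def doubledSwap {N : ℕ} (V : Matrix (Fin N × Fin N) (Fin N × Fin N) ℂ) :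
    Matrix ((Fin N × Fin N) × (Fin N × Fin N)) ((Fin N × Fin N) × (Fin N × Fin N)) ℂ :=
  doubled V * (swapGate N ⊗ₖ 1 + 1 ⊗ₖ swapGate N) * (doubled V)ᴴ

lemma trace_conj_of_commute {ι : Type*} [Fintype ι] [DecidableEq ι] {D X Z : Matrix ι ι ℂ}
    (hD : Dᴴ * D = 1) (hX : Commute D X) : (D * Z * Dᴴ * X).trace = (Z * X).trace := by
  have hX' : Dᴴ * X = X * Dᴴ := by
    have h := congrArg (fun M => Dᴴ * M * Dᴴ) hX.eq
    have hD' : D * Dᴴ = 1 := mul_eq_one_comm.mp hD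
    simpa only [← mul_assoc, hD, one_mul, mul_assoc X, mul_assoc _ D, hD', mul_one] using h.symm
  rw [mul_assoc, hX', ← mul_assoc, trace_mul_comm, ← mul_assoc, ← mul_assoc, hD, one_mul]

lemma swapGate_add_mul_swapGate_kronecker (N : ℕ) :
    (swapGate N ⊗ₖ 1 + 1 ⊗ₖ swapGate N : Matrix ((Fin N × Fin N) × (Fin N × Fin N)) _ ℂ) *
      (swapGate N ⊗ₖ swapGate N) = swapGate N ⊗ₖ 1 + 1 ⊗ₖ swapGate N := by
  simp only [add_mul, ← mul_kronecker_mul, one_mul, swapGate_mul_swapGate, add_comm]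

lemma trace_doubledSwap {N : ℕ} {V : Matrix (Fin N × Fin N) (Fin N × Fin N) ℂ}
    (hV : V ∈ Matrix.unitaryGroup (Fin N × Fin N) ℂ) :
    (doubledSwap V).trace = 2 * (N : ℂ) ^ 3 := by
  have h := trace_conj_of_commute (Z := swapGate N ⊗ₖ 1 + 1 ⊗ₖ swapGate N)
    (conjTranspose_doubled_mul_doubled hV) (Commute.one_right (doubled V))
  rw [mul_one, mul_one] at h
  rw [doubledSwap, h]
  simp only [trace_add, trace_kronecker, trace_swapGate, trace_one,
    Fintype.card_prod, Fintype.card_fin]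
  push_cast
  ring

lemma doubledSwap_mul_swapGate {N : ℕ} {V : Matrix (Fin N × Fin N) (Fin N × Fin N) ℂ} :
    doubledSwap V * (swapGate N ⊗ₖ swapGate N) = doubledSwap V := by
  have h : (doubled V)ᴴ * (swapGate N ⊗ₖ swapGate N) =
      (swapGate N ⊗ₖ swapGate N) * (doubled V)ᴴ := by
    rw [← doubled_conjTranspose, (commute_doubled_swapGate _).eq]
  rw [doubledSwap, mul_assoc, h, ← mul_assoc, mul_assoc (doubled V),
    swapGate_add_mul_swapGate_kronecker]

lemma trace_doubledSwap_mul {N : ℕ} (V : Matrix (Fin N × Fin N) (Fin N × Fin N) ℂ) :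
    (doubledSwap V * (1 ⊗ₖ swapGate N)).trace = purityTrace N V := by
  have h : (1 ⊗ₖ swapGate N : Matrix ((Fin N × Fin N) × (Fin N × Fin N)) _ ℂ) =
      (swapGate N ⊗ₖ swapGate N) * (swapGate N ⊗ₖ 1) := by
    rw [← mul_kronecker_mul, swapGate_mul_swapGate, mul_one]
  rw [h, ← mul_assoc, doubledSwap_mul_swapGate]
  rfl

instance {m n : Type*} [Finite m] [Finite n] : SecondCountableTopology (Matrix m n ℂ) :=
  inferInstanceAs (SecondCountableTopology (m → n → ℂ))

instance {n : Type*} [Fintype n] [DecidableEq n] :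
    SecondCountableTopology (Matrix.unitaryGroup n ℂ) :=
  TopologicalSpace.Subtype.secondCountableTopology (Matrix.unitaryGroup n ℂ : Set (Matrix n n ℂ))

instance {n : Type*} [Fintype n] [DecidableEq n] : CompactSpace (Matrix.unitaryGroup n ℂ) := by
  refine isCompact_iff_compactSpace.mp ?_
  have h : IsCompact (Set.univ.pi fun _ : n => Set.univ.pi fun _ : n =>
      Metric.closedBall (0 : ℂ) 1) :=
    isCompact_univ_pi fun _ => isCompact_univ_pi fun _ => isCompact_closedBall _ _
  refine h.of_isClosed_subset ?_ fun A hA i _ j _ => ?_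
  · have h' : ((Matrix.unitaryGroup n ℂ : Set (Matrix n n ℂ))) = {A | A * star A = 1} := by
      ext A
      exact Matrix.mem_unitaryGroup_iff
    rw [h']
    exact isClosed_eq (continuous_id.matrix_mul continuous_star) continuous_const
  · simpa using entry_norm_bound_of_unitary hA i j

lemma Continuous.integrable_of_compactSpace {X : Type*} [TopologicalSpace X] [CompactSpace X]
    [MeasurableSpace X] [OpensMeasurableSpace X] {ν : Measure X} [IsFiniteMeasure ν]
    {E : Type*} [NormedAddCommGroup E] [SecondCountableTopology E] {f : X → E}
    (hf : Continuous f) : Integrable f ν :=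
  hf.integrable_of_hasCompactSupport (HasCompactSupport.of_compactSpace f)

lemma map_integral_matrix {X : Type*} [TopologicalSpace X] [CompactSpace X]
    [MeasurableSpace X] [OpensMeasurableSpace X] {ν : Measure X} [IsFiniteMeasure ν]
    {m n : Type*} [Fintype m] [Fintype n] [DecidableEq m] [DecidableEq n]
    {F : X → Matrix m n ℂ} (hF : Continuous F) (L : Matrix m n ℂ →ₗ[ℂ] ℂ) :
    L (Matrix.of fun p q => ∫ x, F x p q ∂ν) = ∫ x, L (F x) ∂ν := by
  have hL : ∀ M : Matrix m n ℂ, L M = ∑ p, ∑ q, M p q * L (single p q 1) := by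
    intro M
    conv_lhs => rw [matrix_eq_sum_single M]
    simp only [map_sum]
    refine Finset.sum_congr rfl fun p _ => Finset.sum_congr rfl fun q _ => ?_
    rw [← smul_eq_mul, ← map_smul, smul_single, smul_eq_mul, mul_one]
  have hi : ∀ p q, Integrable (fun x => F x p q * L (single p q 1)) ν := fun p q =>
    ((hF.matrix_elem p q).mul continuous_const).integrable_of_compactSpace
  rw [hL, integral_congr_ae (ae_of_all _ fun x => hL (F x)),
    integral_finsetSum _ fun p _ => integrable_finsetSum _ fun q _ => hi p q]
  refine Finset.sum_congr rfl fun p _ => ?_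
  rw [integral_finsetSum _ fun q _ => hi p q]
  exact Finset.sum_congr rfl fun q _ => (integral_mul_const _ _).symm

lemma unitary_kronecker {N : ℕ}
    (g : Matrix.unitaryGroup (Fin N) ℂ × Matrix.unitaryGroup (Fin N) ℂ) :
    ((g.1 : Matrix (Fin N) (Fin N) ℂ) ⊗ₖ (g.2 : Matrix (Fin N) (Fin N) ℂ)) ∈
      Matrix.unitaryGroup (Fin N × Fin N) ℂ :=
  Matrix.kronecker_mem_unitary g.1.2 g.2.2

/-- The doubled local gate. -/
def doubledLocal {N : ℕ} (g : Matrix.unitaryGroup (Fin N) ℂ × Matrix.unitaryGroup (Fin N) ℂ) :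
    Matrix ((Fin N × Fin N) × (Fin N × Fin N)) ((Fin N × Fin N) × (Fin N × Fin N)) ℂ :=
  doubled ((g.1 : Matrix (Fin N) (Fin N) ℂ) ⊗ₖ (g.2 : Matrix (Fin N) (Fin N) ℂ))

lemma doubledLocal_mul {N : ℕ}
    (g h : Matrix.unitaryGroup (Fin N) ℂ × Matrix.unitaryGroup (Fin N) ℂ) :
    doubledLocal (g * h) = doubledLocal g * doubledLocal h := by
  rw [doubledLocal, doubledLocal, doubledLocal, ← doubled_mul, ← mul_kronecker_mul]
  rfl

lemma continuous_doubled {N : ℕ} : Continuous (doubled (N := N)) := by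
  refine continuous_matrix fun p q => ?_
  simp only [doubled_apply]
  fun_prop

lemma continuous_kronecker_unitary {N : ℕ} :
    Continuous fun g : Matrix.unitaryGroup (Fin N) ℂ × Matrix.unitaryGroup (Fin N) ℂ =>
      (g.1 : Matrix (Fin N) (Fin N) ℂ) ⊗ₖ (g.2 : Matrix (Fin N) (Fin N) ℂ) := by
  refine continuous_matrix fun p q => ?_
  exact ((continuous_subtype_val.comp continuous_fst).matrix_elem _ _).mul
    ((continuous_subtype_val.comp continuous_snd).matrix_elem _ _)

lemma continuous_doubledLocal {N : ℕ} : Continuous (doubledLocal (N := N)) :=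
  continuous_doubled.comp continuous_kronecker_unitary

/-- Twirling over local unitaries. -/
def twirl {N : ℕ} (μ : Measure (Matrix.unitaryGroup (Fin N) ℂ))
    (Z : Matrix ((Fin N × Fin N) × (Fin N × Fin N)) ((Fin N × Fin N) × (Fin N × Fin N)) ℂ) :
    Matrix ((Fin N × Fin N) × (Fin N × Fin N)) ((Fin N × Fin N) × (Fin N × Fin N)) ℂ :=
  Matrix.of fun p q => ∫ g, (doubledLocal g * Z * (doubledLocal g)ᴴ) p q ∂(μ.prod μ)

section twirl

variable {N : ℕ} (μ : Measure (Matrix.unitaryGroup (Fin N) ℂ)) [IsProbabilityMeasure μ]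
  (Z X : Matrix ((Fin N × Fin N) × (Fin N × Fin N)) ((Fin N × Fin N) × (Fin N × Fin N)) ℂ)

lemma map_twirl (L : Matrix ((Fin N × Fin N) × (Fin N × Fin N))
    ((Fin N × Fin N) × (Fin N × Fin N)) ℂ →ₗ[ℂ] ℂ) :
    L (twirl μ Z) = ∫ g, L (doubledLocal g * Z * (doubledLocal g)ᴴ) ∂(μ.prod μ) :=
  map_integral_matrix ((continuous_doubledLocal.mul continuous_const).mul
    continuous_doubledLocal.matrix_conjTranspose) L

lemma trace_twirl_mul :
    (twirl μ Z * X).trace =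
      ∫ g, (doubledLocal g * Z * (doubledLocal g)ᴴ * X).trace ∂(μ.prod μ) :=
  map_twirl μ Z (Matrix.traceLinearMap _ ℂ ℂ ∘ₗ LinearMap.mulRight ℂ X)

lemma conj_twirl [μ.IsHaarMeasure]
    (h : Matrix.unitaryGroup (Fin N) ℂ × Matrix.unitaryGroup (Fin N) ℂ) :
    doubledLocal h * twirl μ Z * (doubledLocal h)ᴴ = twirl μ Z := by
  ext p q
  have := map_twirl μ Z (Matrix.entryLinearMap ℂ ℂ p q ∘ₗ
    LinearMap.mulRight ℂ (doubledLocal h)ᴴ ∘ₗ LinearMap.mulLeft ℂ (doubledLocal h))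
  simp only [LinearMap.comp_apply, LinearMap.mulRight_apply, LinearMap.mulLeft_apply,
    Matrix.entryLinearMap_apply] at this
  rw [this, twirl, of_apply]
  refine Eq.trans ?_ (integral_mul_left_eq_self
    (fun g => (doubledLocal g * Z * (doubledLocal g)ᴴ) p q) h)
  refine integral_congr_ae (ae_of_all _ fun g => ?_)
  simp only [doubledLocal_mul, conjTranspose_mul, mul_assoc]

lemma commute_twirl [μ.IsHaarMeasure]
    (h : Matrix.unitaryGroup (Fin N) ℂ × Matrix.unitaryGroup (Fin N) ℂ) :
    Commute (doubledLocal h) (twirl μ Z) := by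
  have hD := conjTranspose_doubled_mul_doubled (unitary_kronecker h)
  have := congrArg (· * doubledLocal h) (conj_twirl μ Z h)
  beta_reduce at this
  rwa [mul_assoc, doubledLocal, hD, mul_one] at this

lemma trace_twirl_mul_of_commute (hX : ∀ g, Commute (doubledLocal g) X) :
    (twirl μ Z * X).trace = (Z * X).trace := by
  rw [trace_twirl_mul]
  simp only [fun g => trace_conj_of_commute (Z := Z) (D := doubledLocal g) (X := X)
    (conjTranspose_doubled_mul_doubled (unitary_kronecker g)) (hX g), integral_const]
  simp

end twirl

lemma exists_twirl_eq {N : ℕ} (hN : 2 ≤ N) (μ : Measure (Matrix.unitaryGroup (Fin N) ℂ))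
    [μ.IsHaarMeasure] [IsProbabilityMeasure μ]
    (Z : Matrix ((Fin N × Fin N) × (Fin N × Fin N)) ((Fin N × Fin N) × (Fin N × Fin N)) ℂ) :
    ∃ a b c d : ℂ, twirl μ Z = a • 1 + b • (swapGate N ⊗ₖ 1) + c • (1 ⊗ₖ swapGate N) +
      d • (swapGate N ⊗ₖ swapGate N) := by
  refine exists_eq_add_smul_kronecker_swapGate (fun u hu => ?_) (fun u hu => ?_)
    (o := ⟨0, by lia⟩) (t := ⟨1, by lia⟩) (by simp)
  · simpa [doubledLocal, doubled_kronecker] using commute_twirl μ Z (⟨u, hu⟩, 1)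
  · simpa [doubledLocal, doubled_kronecker] using commute_twirl μ Z (1, ⟨u, hu⟩)

lemma commute_doubledLocal_swapGate_left {N : ℕ}
    (g : Matrix.unitaryGroup (Fin N) ℂ × Matrix.unitaryGroup (Fin N) ℂ) :
    Commute (doubledLocal g) (swapGate N ⊗ₖ 1) := by
  rw [doubledLocal, doubled_kronecker, Commute, SemiconjBy, ← mul_kronecker_mul,
    ← mul_kronecker_mul, (commute_kronecker_self_swapGate _).eq, one_mul, mul_one]

lemma commute_doubledLocal_swapGate_right {N : ℕ}
    (g : Matrix.unitaryGroup (Fin N) ℂ × Matrix.unitaryGroup (Fin N) ℂ) :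
    Commute (doubledLocal g) (1 ⊗ₖ swapGate N) := by
  rw [doubledLocal, doubled_kronecker, Commute, SemiconjBy, ← mul_kronecker_mul,
    ← mul_kronecker_mul, (commute_kronecker_self_swapGate _).eq, one_mul, mul_one]

/-- The average of `purityTrace` over an interlacing local gate. -/
lemma integral_purityTrace {N : ℕ} (hN : 2 ≤ N) (μ : Measure (Matrix.unitaryGroup (Fin N) ℂ))
    [μ.IsHaarMeasure] [IsProbabilityMeasure μ] {U V : Matrix (Fin N × Fin N) (Fin N × Fin N) ℂ}
    (hU : U ∈ Matrix.unitaryGroup (Fin N × Fin N) ℂ)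
    (hV : V ∈ Matrix.unitaryGroup (Fin N × Fin N) ℂ) :
    (N : ℂ) ^ 2 * ((N : ℂ) ^ 2 - 1) ^ 2 *
      (∫ g, purityTrace N (U * ((g.1 : Matrix (Fin N) (Fin N) ℂ) ⊗ₖ
        (g.2 : Matrix (Fin N) (Fin N) ℂ)) * V) ∂(μ.prod μ) - purityTrace N V) =
      (purityTrace N V * ((N : ℂ) ^ 2 + 1) - 4 * (N : ℂ) ^ 4) *
        (purityTrace N U - (N : ℂ) ^ 2 * ((N : ℂ) ^ 2 + 1)) := by
  have hUU := conjTranspose_doubled_mul_doubled hU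
  have hUU' : doubled U * (doubled U)ᴴ = 1 := mul_eq_one_comm.mp hUU
  have hint : ∀ g : Matrix.unitaryGroup (Fin N) ℂ × Matrix.unitaryGroup (Fin N) ℂ,
      purityTrace N (U * ((g.1 : Matrix (Fin N) (Fin N) ℂ) ⊗ₖ
        (g.2 : Matrix (Fin N) (Fin N) ℂ)) * V) =
      (doubledLocal g * doubledSwap V * (doubledLocal g)ᴴ *
        ((doubled U)ᴴ * (swapGate N ⊗ₖ 1) * doubled U)).trace := by
    intro g
    rw [purityTrace, doubled_mul, doubled_mul, ← mul_assoc _ _ (doubled U),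
      trace_mul_comm _ (doubled U)]
    simp only [conjTranspose_mul, doubledSwap, doubledLocal, mul_assoc]
  obtain ⟨a, b, c, d, hE⟩ := exists_twirl_eq hN μ (doubledSwap V)
  simp only [hint]
  rw [← trace_twirl_mul]
  refine trace_mul_eq_of_swapGate_components hN hE ?_ ?_ ?_ ?_ ?_ ?_ ?_
  · have h := trace_twirl_mul_of_commute μ (doubledSwap V) 1 fun g => Commute.one_right _
    rw [mul_one, mul_one] at h
    rw [h, trace_doubledSwap hV]
  · rw [trace_twirl_mul_of_commute μ _ _ fun g => commute_doubled_swapGate _,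
      doubledSwap_mul_swapGate, trace_doubledSwap hV]
  · exact trace_twirl_mul_of_commute μ _ _ commute_doubledLocal_swapGate_left
  · rw [trace_twirl_mul_of_commute μ _ _ commute_doubledLocal_swapGate_right,
      trace_doubledSwap_mul]
  · rw [trace_mul_comm, ← mul_assoc, hUU', one_mul, trace_kronecker, trace_swapGate, trace_one,
      Fintype.card_prod, Fintype.card_fin]
    push_cast
    ring
  · rw [← mul_assoc, trace_mul_comm, ← mul_assoc, ← mul_assoc, (commute_doubled_swapGate U).eq,
      mul_assoc _ (doubled U), hUU', mul_one, ← mul_kronecker_mul, swapGate_mul_swapGate, mul_one,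
      trace_kronecker, trace_swapGate, trace_one, Fintype.card_prod, Fintype.card_fin]
    push_cast
    ring
  · rw [← mul_assoc, trace_mul_comm, ← mul_assoc, ← mul_assoc, purityTrace]

lemma continuous_purityTrace (N : ℕ) : Continuous (purityTrace N) :=
  (((continuous_doubled.mul continuous_const).mul
    continuous_doubled.matrix_conjTranspose).mul continuous_const).matrix_trace

lemma continuous_ep {N : ℕ} (hN : 2 ≤ N) : Continuous (ep N) := by
  rw [funext fun V => ep_eq hN V]
  have := continuous_purityTrace N
  fun_prop

/-- The average of the entangling power over one interlacing local gate. -/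
lemma integral_ep {N : ℕ} (hN : 2 ≤ N) (μ : Measure (Matrix.unitaryGroup (Fin N) ℂ))
    [μ.IsHaarMeasure] [IsProbabilityMeasure μ] {U V : Matrix (Fin N × Fin N) (Fin N × Fin N) ℂ}
    (hU : U ∈ Matrix.unitaryGroup (Fin N × Fin N) ℂ)
    (hV : V ∈ Matrix.unitaryGroup (Fin N × Fin N) ℂ) :
    ∫ g, ep N (U * ((g.1 : Matrix (Fin N) (Fin N) ℂ) ⊗ₖ
      (g.2 : Matrix (Fin N) (Fin N) ℂ)) * V) ∂(μ.prod μ) =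
      ep N U + ep N V - ep N U * ep N V / epBar N := by
  have hre : ∀ T : Matrix (Fin N × Fin N) (Fin N × Fin N) ℂ,
      purityTrace N T = ((purityTrace N T).re : ℂ) := fun T =>
    Complex.ext rfl (purityTrace_im N T)
  have hc : Continuous fun g : Matrix.unitaryGroup (Fin N) ℂ × Matrix.unitaryGroup (Fin N) ℂ =>
      (purityTrace N (U * ((g.1 : Matrix (Fin N) (Fin N) ℂ) ⊗ₖ
        (g.2 : Matrix (Fin N) (Fin N) ℂ)) * V)).re :=
    Complex.continuous_re.comp ((continuous_purityTrace N).comp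
      ((continuous_const.mul continuous_kronecker_unitary).mul continuous_const))
  have h := integral_purityTrace hN μ hU hV
  rw [integral_congr_ae (ae_of_all _ fun g => hre _), integral_complex_ofReal, hre U, hre V] at h
  norm_cast at h
  simp only [ep_eq hN]
  rw [integral_div, integral_sub (integrable_const _) hc.integrable_of_compactSpace]
  simp only [integral_const, probReal_univ, one_smul]
  have hN2 : (2 : ℝ) ≤ N := by exact_mod_cast hN
  have hN0 : (N : ℝ) ≠ 0 := by positivity
  have hN1 : (N : ℝ) + 1 ≠ 0 := by positivity
  have hN3 : (N : ℝ) - 1 ≠ 0 := by linarith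
  have hN4 : (N : ℝ) ^ 2 + 1 ≠ 0 := by positivity
  push_cast at h
  generalize ∫ g, (purityTrace N (U * ((g.1 : Matrix (Fin N) (Fin N) ℂ) ⊗ₖ
    (g.2 : Matrix (Fin N) (Fin N) ℂ)) * V)).re ∂(μ.prod μ) = I at h ⊢
  generalize (purityTrace N U).re = u at h ⊢
  generalize (purityTrace N V).re = v at h ⊢
  rw [epBar]
  field_simp
  linear_combination (-1) * h

lemma continuous_iterGate {X D : Type*} [TopologicalSpace X] [Fintype D] [DecidableEq D]
    (U : Matrix D D ℂ) {W : X → ℕ → Matrix D D ℂ} (hW : ∀ k, Continuous fun x => W x k) (m : ℕ) :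
    Continuous fun x => iterGate U (W x) m := by
  induction m with
  | zero => exact continuous_const
  | succ m ih => exact (continuous_const.mul (hW m)).mul ih

lemma iterGate_mem_unitaryGroup {D : Type*} [Fintype D] [DecidableEq D] {U : Matrix D D ℂ}
    (hU : U ∈ Matrix.unitaryGroup D ℂ) {W : ℕ → Matrix D D ℂ}
    (hW : ∀ k, W k ∈ Matrix.unitaryGroup D ℂ) (m : ℕ) :
    iterGate U W m ∈ Matrix.unitaryGroup D ℂ := by
  induction m with
  | zero => exact hU
  | succ m ih => exact mul_mem (mul_mem hU (hW m)) ih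

lemma iterGate_congr {D : Type*} [Fintype D] [DecidableEq D] (U : Matrix D D ℂ)
    {W W' : ℕ → Matrix D D ℂ} {m : ℕ} (h : ∀ k < m, W k = W' k) :
    iterGate U W m = iterGate U W' m := by
  induction m with
  | zero => rfl
  | succ m ih =>
    rw [iterGate, iterGate, h m m.lt_succ_self, ih fun k hk => h k (hk.trans m.lt_succ_self)]

/-- The sequence of local gates determined by finitely many pairs of local unitaries. -/
def localGates {N m : ℕ}
    (g : Fin m → Matrix.unitaryGroup (Fin N) ℂ × Matrix.unitaryGroup (Fin N) ℂ) (k : ℕ) :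
    Matrix (Fin N × Fin N) (Fin N × Fin N) ℂ :=
  if h : k < m then ((g ⟨k, h⟩).1 : Matrix (Fin N) (Fin N) ℂ) ⊗ₖ
    ((g ⟨k, h⟩).2 : Matrix (Fin N) (Fin N) ℂ) else 1

lemma localGates_mem_unitaryGroup {N m : ℕ}
    (g : Fin m → Matrix.unitaryGroup (Fin N) ℂ × Matrix.unitaryGroup (Fin N) ℂ) (k : ℕ) :
    localGates g k ∈ Matrix.unitaryGroup (Fin N × Fin N) ℂ := by
  rw [localGates]
  split_ifs
  · exact unitary_kronecker _
  · exact one_mem _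

lemma continuous_localGates {N m : ℕ} (k : ℕ) :
    Continuous fun g : Fin m → Matrix.unitaryGroup (Fin N) ℂ × Matrix.unitaryGroup (Fin N) ℂ =>
      localGates g k := by
  by_cases h : k < m
  · simp only [localGates, h, dite_true]
    exact continuous_kronecker_unitary.comp (continuous_apply _)
  · simp only [localGates, h, dite_false]
    exact continuous_const

lemma iterGate_localGates_succ {N m : ℕ} (U : Matrix (Fin N × Fin N) (Fin N × Fin N) ℂ)
    (g : Fin (m + 1) → Matrix.unitaryGroup (Fin N) ℂ × Matrix.unitaryGroup (Fin N) ℂ) :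
    iterGate U (localGates g) (m + 1) = U * (((g (Fin.last m)).1 : Matrix (Fin N) (Fin N) ℂ) ⊗ₖ
      ((g (Fin.last m)).2 : Matrix (Fin N) (Fin N) ℂ)) *
        iterGate U (localGates fun j => g ((Fin.last m).succAbove j)) m := by
  have hm : localGates g m = ((g (Fin.last m)).1 : Matrix (Fin N) (Fin N) ℂ) ⊗ₖ
      ((g (Fin.last m)).2 : Matrix (Fin N) (Fin N) ℂ) := by
    rw [localGates, dif_pos m.lt_succ_self]
    rfl
  rw [iterGate, hm, iterGate_congr (W' := localGates fun j => g ((Fin.last m).succAbove j)) U]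
  intro k hk
  rw [localGates, localGates, dif_pos hk, dif_pos (hk.trans m.lt_succ_self)]
  simp only [Fin.succAbove_last]
  rfl

lemma integral_ep_iterGate {N : ℕ} (hN : 2 ≤ N) {U : Matrix (Fin N × Fin N) (Fin N × Fin N) ℂ}
    (hU : U ∈ Matrix.unitaryGroup (Fin N × Fin N) ℂ)
    (μ : Measure (Matrix.unitaryGroup (Fin N) ℂ)) [μ.IsHaarMeasure] [IsProbabilityMeasure μ]
    (m : ℕ) :
    ∫ g : Fin m → Matrix.unitaryGroup (Fin N) ℂ × Matrix.unitaryGroup (Fin N) ℂ,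
        ep N (iterGate U (localGates g) m) ∂(Measure.pi fun _ => μ.prod μ) =
      epBar N * (1 - (1 - ep N U / epBar N) ^ (m + 1)) := by
  have hbar : epBar N ≠ 0 := by
    have hN2 : (2 : ℝ) ≤ N := by exact_mod_cast hN
    have : (N : ℝ) - 1 ≠ 0 := by linarith
    rw [epBar]
    positivity
  induction m with
  | zero =>
    simp only [iterGate, integral_const, probReal_univ, one_smul]
    rw [zero_add, pow_one, sub_sub_cancel, mul_div_cancel₀ _ hbar]
  | succ m ih =>
    have hc : Continuous fun g : Fin m →
        Matrix.unitaryGroup (Fin N) ℂ × Matrix.unitaryGroup (Fin N) ℂ =>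
          iterGate U (localGates g) m := continuous_iterGate U continuous_localGates m
    have hi : Integrable (fun g : Fin m →
        Matrix.unitaryGroup (Fin N) ℂ × Matrix.unitaryGroup (Fin N) ℂ =>
          ep N (iterGate U (localGates g) m)) (Measure.pi fun _ => μ.prod μ) :=
      ((continuous_ep hN).comp hc).integrable_of_compactSpace
    have hstep := (measurePreserving_piFinSuccAbove (fun _ : Fin (m + 1) => μ.prod μ)
      (Fin.last m)).integral_comp' fun p => ep N (U * ((p.1.1 : Matrix (Fin N) (Fin N) ℂ) ⊗ₖ
        (p.1.2 : Matrix (Fin N) (Fin N) ℂ)) * iterGate U (localGates p.2) m)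
    have hci : Continuous fun p : (Matrix.unitaryGroup (Fin N) ℂ × Matrix.unitaryGroup (Fin N) ℂ) ×
        (Fin m → Matrix.unitaryGroup (Fin N) ℂ × Matrix.unitaryGroup (Fin N) ℂ) =>
        ep N (U * ((p.1.1 : Matrix (Fin N) (Fin N) ℂ) ⊗ₖ
        (p.1.2 : Matrix (Fin N) (Fin N) ℂ)) * iterGate U (localGates p.2) m) :=
      (continuous_ep hN).comp ((continuous_const.mul
        (continuous_kronecker_unitary.comp continuous_fst)).mul (hc.comp continuous_snd))
    rw [integral_prod_symm _ hci.integrable_of_compactSpace] at hstep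
    simp only [iterGate_localGates_succ]
    refine hstep.trans ?_
    simp only [integral_ep hN μ hU
      (iterGate_mem_unitaryGroup hU (localGates_mem_unitaryGroup _) m)]
    have haff : ∀ x, ep N U + x - ep N U * x / epBar N =
        ep N U + (1 - ep N U / epBar N) * x := fun x => by ring
    simp only [haff]
    rw [integral_add (integrable_const _) (hi.const_mul _), integral_const_mul, ih]
    simp only [integral_const, probReal_univ, one_smul]
    have he : ep N U = epBar N * (ep N U / epBar N) := (mul_div_cancel₀ _ hbar).symm
    generalize ep N U / epBar N = r at he ⊢
    rw [he]
    ring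

/-- For a unitary `U` on `ℂ^N ⊗ ℂ^N` and `n ≥ 1`, the average of the
entangling power of `U^(n) = U·W_{n-1}·U ⋯ W_1·U` over the interlacing local gates
`W_j = U^A_j ⊗ U^B_j`, with all local unitaries drawn independently from the Haar
probability measure on `U(N)`, equals `ē_p (1 - (1 - e_p(U)/ē_p)^n)`. -/
theorem entangling_power_iterated_average (N : ℕ) (hN : 2 ≤ N)
    (U : Matrix (Fin N × Fin N) (Fin N × Fin N) ℂ)
    (hU : U ∈ Matrix.unitaryGroup (Fin N × Fin N) ℂ)
    (μ : Measure (Matrix.unitaryGroup (Fin N) ℂ)) [μ.IsHaarMeasure] [IsProbabilityMeasure μ]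
    (n : ℕ) (hn : 1 ≤ n) :
    (∫ g : Fin (n - 1) → Matrix.unitaryGroup (Fin N) ℂ × Matrix.unitaryGroup (Fin N) ℂ,
        ep N (iterGate U
          (fun k => if h : k < n - 1 then
              ((g ⟨k, h⟩).1 : Matrix (Fin N) (Fin N) ℂ) ⊗ₖ
                ((g ⟨k, h⟩).2 : Matrix (Fin N) (Fin N) ℂ)
            else 1) (n - 1))
        ∂(Measure.pi fun _ => μ.prod μ))
      = epBar N * (1 - (1 - ep N U / epBar N) ^ n) := by
  obtain ⟨m, rfl⟩ := Nat.exists_eq_add_of_le' hn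
  exact integral_ep_iterGate hN hU μ m
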